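/- Let n ≥ 2 and let f : ℝⁿ → ℝ be a C² function. Then the infimum over all x ∈ ℝⁿ of |H(x)| equals 0; equivalently, for every ε > 0 there exists x ∈ ℝⁿ with |H(x)| < ε. In particular an entire graph in ℝ^{n+1} cannot have mean curvature bounded away from zero. -/

import Mathlib

open Metric Finset

/-- Coordinates of the gradient of `f` at `x`. -/
noncomputable def grad (n : ℕ) (f : EuclideanSpace ℝ (Fin n) → ℝ)
    (x : EuclideanSpace ℝ (Fin n)) : Fin n → ℝ :=
  fun i => fderiv ℝ f x (EuclideanSpace.single i 1)

/-- The Hessian matrix `D²f(x)`. -/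
noncomputable def hess (n : ℕ) (f : EuclideanSpace ℝ (Fin n) → ℝ)
    (x : EuclideanSpace ℝ (Fin n)) : Matrix (Fin n) (Fin n) ℝ :=
  Matrix.of fun i j =>
    fderiv ℝ (fun y => fderiv ℝ f y (EuclideanSpace.single j 1)) x (EuclideanSpace.single i 1)

/-- `|∇f(x)|²`. -/
noncomputable def gradSq (n : ℕ) (f : EuclideanSpace ℝ (Fin n) → ℝ)
    (x : EuclideanSpace ℝ (Fin n)) : ℝ :=
  ∑ i, grad n f x i ^ 2

/-- The shape operator of the graph of `f`, with respect to the upward unit normal: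
`W(x) = (1+|∇f|²)^{-1/2} (Iₙ - ∇f ∇fᵀ/(1+|∇f|²)) D²f(x)`. -/
noncomputable def shapeOp (n : ℕ) (f : EuclideanSpace ℝ (Fin n) → ℝ)
    (x : EuclideanSpace ℝ (Fin n)) : Matrix (Fin n) (Fin n) ℝ :=
  (Real.sqrt (1 + gradSq n f x))⁻¹ •
    (((1 : Matrix (Fin n) (Fin n) ℝ) -
      Matrix.of fun i j => grad n f x i * grad n f x j / (1 + gradSq n f x)) * hess n f x)

/-- The mean curvature `H(x) = tr W(x) / n`. -/
noncomputable def meanCurv (n : ℕ) (f : EuclideanSpace ℝ (Fin n) → ℝ)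
    (x : EuclideanSpace ℝ (Fin n)) : ℝ :=
  (shapeOp n f x).trace / n

/-- The scalar curvature `R(x) = ((tr W)² - tr(W²)) / (n(n-1))`. -/
noncomputable def scalarCurv (n : ℕ) (f : EuclideanSpace ℝ (Fin n) → ℝ)
    (x : EuclideanSpace ℝ (Fin n)) : ℝ :=
  ((shapeOp n f x).trace ^ 2 - (shapeOp n f x * shapeOp n f x).trace) /
    ((n : ℝ) * ((n : ℝ) - 1))

/-- The length `|A|(x) = √(tr(W(x)²))` of the second fundamental form. -/
noncomputable def normA (n : ℕ) (f : EuclideanSpace ℝ (Fin n) → ℝ)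
    (x : EuclideanSpace ℝ (Fin n)) : ℝ :=
  Real.sqrt ((shapeOp n f x * shapeOp n f x).trace)

/-- Second-order necessary condition at a local maximum of a function of one real variable. -/
theorem IsLocalMax.second_deriv_nonpos {φ φ' : ℝ → ℝ} {a c : ℝ} (hmax : IsLocalMax φ a)
    (h1 : ∀ᶠ t in nhds a, HasDerivAt φ (φ' t) t) (h2 : HasDerivAt φ' c a) : c ≤ 0 := by
  by_contra! hc
  have hd : deriv φ =ᶠ[nhds a] φ' := h1.mono fun t ht => ht.deriv
  have hdd : deriv (deriv φ) a = c := by rw [hd.deriv_eq, h2.deriv]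
  have hmin : IsLocalMin φ a :=
    isLocalMin_of_deriv_deriv_pos (by rw [hdd]; exact hc) hmax.deriv_eq_zero
      h1.self_of_nhds.continuousAt
  have hconst : φ =ᶠ[nhds a] fun _ => φ a := by
    filter_upwards [hmin, hmax] with t ht ht' using le_antisymm ht' ht
  have h0 : deriv (deriv φ) a = 0 := by
    rw [hconst.deriv.deriv_eq]
    simp
  linarith

theorem sum_smul_single {n : ℕ} (x : EuclideanSpace ℝ (Fin n)) :
    ∑ i, x i • EuclideanSpace.single i (1 : ℝ) = x := by
  ext j
  simp [Finset.sum_apply, Pi.single_apply]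

/-- The trace of a negative semidefinite bilinear form against the positive matrix
`I - x xᵀ / R²`, where `|x|² = R² - s²`, is nonpositive. -/
theorem sum_bilin_le_of_nonpos {n : ℕ}
    (B : EuclideanSpace ℝ (Fin n) →ₗ[ℝ] EuclideanSpace ℝ (Fin n) →ₗ[ℝ] ℝ)
    (hB : ∀ v, B v v ≤ 0) {R s : ℝ} (hR : 0 < R) (hs : 0 ≤ s)
    (x : EuclideanSpace ℝ (Fin n)) (hx : ∑ i, x i ^ 2 = R ^ 2 - s ^ 2) :
    ∑ i, B (EuclideanSpace.single i 1) (EuclideanSpace.single i 1) - B x x / R ^ 2 ≤ 0 := by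
  set c : ℝ := (R * (R + s))⁻¹ with hc
  have hsum := sum_smul_single x
  have h1 : ∑ i, x i * B (EuclideanSpace.single i 1) x = B x x := by
    calc _ = B (∑ i, x i • EuclideanSpace.single i (1 : ℝ)) x := by
          simp [map_sum, LinearMap.sum_apply]
      _ = B x x := by rw [hsum]
  have h2 : ∑ i, x i * B x (EuclideanSpace.single i 1) = B x x := by
    calc _ = B x (∑ i, x i • EuclideanSpace.single i (1 : ℝ)) := by simp [map_sum]
      _ = B x x := by rw [hsum]
  have key : ∑ i, B (EuclideanSpace.single i 1 - (c * x i) • x)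
      (EuclideanSpace.single i 1 - (c * x i) • x) =
      ∑ i, B (EuclideanSpace.single i 1) (EuclideanSpace.single i 1) - B x x / R ^ 2 := by
    have : ∀ i, B (EuclideanSpace.single i 1 - (c * x i) • x)
        (EuclideanSpace.single i 1 - (c * x i) • x) =
        B (EuclideanSpace.single i 1) (EuclideanSpace.single i 1)
          - c * (x i * B (EuclideanSpace.single i 1) x)
          - c * (x i * B x (EuclideanSpace.single i 1)) + c ^ 2 * B x x * x i ^ 2 := by
      intro i
      simp only [map_sub, map_smul, LinearMap.sub_apply, LinearMap.smul_apply, smul_eq_mul]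
      ring
    simp only [this, Finset.sum_add_distrib, Finset.sum_sub_distrib, ← Finset.mul_sum, h1, h2, hx]
    have hRs : 0 < R + s := by linarith
    rw [hc]
    field_simp
    ring
  rw [← key]
  exact Finset.sum_nonpos fun i _ => hB _

section Calculus

variable {n : ℕ} {f : EuclideanSpace ℝ (Fin n) → ℝ}

theorem ContDiff.contDiff_one_fderiv (hf : ContDiff ℝ 2 f) : ContDiff ℝ 1 (fderiv ℝ f) :=
  hf.fderiv_right (by norm_num)

theorem hess_apply (hf : ContDiff ℝ 2 f) (x : EuclideanSpace ℝ (Fin n)) (i j : Fin n) :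
    hess n f x i j =
      fderiv ℝ (fderiv ℝ f) x (EuclideanSpace.single i 1) (EuclideanSpace.single j 1) := by
  have h : DifferentiableAt ℝ (fderiv ℝ f) x :=
    (hf.contDiff_one_fderiv.differentiable one_ne_zero) x
  simp only [hess, Matrix.of_apply]
  rw [fderiv_clm_apply h (differentiableAt_const _)]
  simp

theorem trace_shapeOp (x : EuclideanSpace ℝ (Fin n)) :
    (shapeOp n f x).trace = (Real.sqrt (1 + gradSq n f x))⁻¹ *
      (∑ i, hess n f x i i -
        (∑ i, ∑ j, grad n f x i * grad n f x j * hess n f x j i) / (1 + gradSq n f x)) := by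
  rw [shapeOp, Matrix.trace_smul, sub_mul, Matrix.trace_sub, one_mul, smul_eq_mul]
  congr 2
  simp only [Matrix.trace, Matrix.diag_apply, Matrix.mul_apply, Matrix.of_apply, Finset.sum_div]
  refine Finset.sum_congr rfl fun i _ => Finset.sum_congr rfl fun j _ => ?_
  ring

theorem gradSq_nonneg (x : EuclideanSpace ℝ (Fin n)) : 0 ≤ gradSq n f x :=
  Finset.sum_nonneg fun _ _ => sq_nonneg _

theorem continuous_meanCurv (hf : ContDiff ℝ 2 f) : Continuous (meanCurv n f) := by
  have hg : ∀ i, Continuous fun x => grad n f x i := fun i =>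
    hf.contDiff_one_fderiv.continuous.clm_apply continuous_const
  have hh : ∀ i j, Continuous fun x => hess n f x i j := fun i j => by
    simp only [hess_apply hf]
    exact ((hf.contDiff_one_fderiv.continuous_fderiv one_ne_zero).clm_apply
      continuous_const).clm_apply continuous_const
  have hq : Continuous (gradSq n f) := continuous_finsetSum _ fun i _ => (hg i).pow 2
  have hpos : ∀ x, 0 < 1 + gradSq n f x := fun x => by
    have := gradSq_nonneg (f := f) x
    linarith
  have : meanCurv n f = fun x => (shapeOp n f x).trace / n := rfl
  rw [this]
  simp only [trace_shapeOp]
  refine Continuous.div_const (Continuous.mul (Continuous.inv₀ (by fun_prop) fun x =>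
    (Real.sqrt_pos.2 (hpos x)).ne') (Continuous.sub (by fun_prop)
      (Continuous.div (by fun_prop) (by fun_prop) fun x => (hpos x).ne'))) _

theorem meanCurv_neg (x : EuclideanSpace ℝ (Fin n)) : meanCurv n (-f) x = -meanCurv n f x := by
  have hg : ∀ i, grad n (-f) x i = -grad n f x i := fun i => by
    simp [grad, fderiv_neg]
  have hh : ∀ i j, hess n (-f) x i j = -hess n f x i j := fun i j => by
    simp only [hess, Matrix.of_apply, fderiv_neg, neg_apply]
    rw [fderiv_fun_neg, neg_apply]
  have hq : gradSq n (-f) x = gradSq n f x := by simp [gradSq, hg]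
  simp only [meanCurv, trace_shapeOp, hq, hg, hh, mul_neg, neg_mul, neg_neg, Finset.sum_neg_distrib]
  ring

end Calculus

section Touching

variable {n : ℕ} {f : EuclideanSpace ℝ (Fin n) → ℝ}

/-- If `f + √(R² - |·|²)` is maximal on the closed ball of radius `R`, then the maximum point is
in the open ball. -/
theorem norm_lt_of_isMaxOn_add_sqrt (hf : ContDiff ℝ 2 f) {R : ℝ} (hR : 0 < R)
    {x : EuclideanSpace ℝ (Fin n)} (hx : x ∈ closedBall 0 R)
    (hmax : IsMaxOn (fun y => f y + √(R ^ 2 - ‖y‖ ^ 2)) (closedBall 0 R) x) : ‖x‖ < R := by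
  rw [mem_closedBall_zero_iff] at hx
  refine lt_of_le_of_ne hx fun hxR => ?_
  obtain ⟨K, U, hU, hK⟩ := (hf.of_le (by norm_num : (1 : WithTop ℕ∞) ≤ 2)).contDiffAt
    (x := x) |>.exists_lipschitzOnWith
  have hpath : Filter.Tendsto (fun t : ℝ => (1 - t) • x) (nhds 0) (nhds x) := by
    have : Continuous fun t : ℝ => (1 - t) • x := by fun_prop
    simpa using this.tendsto 0
  have hsmall : ∀ᶠ t : ℝ in nhds 0, (K ^ 2 + 1) * t < 1 :=
    (show Continuous fun t : ℝ => (K ^ 2 + 1) * t by fun_prop).continuousAt.eventually_lt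
      continuousAt_const (by simp)
  obtain ⟨t, ⟨⟨htU, hts⟩, ht1⟩, ht0⟩ := (((((hpath.eventually hU).and hsmall).and
    (gt_mem_nhds (zero_lt_one (α := ℝ)))).filter_mono nhdsWithin_le_nhds).and
      (self_mem_nhdsWithin (s := Set.Ioi (0 : ℝ)))).exists
  have hnorm : ‖(1 - t) • x‖ = (1 - t) * R := by
    rw [norm_smul, Real.norm_of_nonneg (by linarith), hxR]
  have hm : f ((1 - t) • x) + √(R ^ 2 - ‖(1 - t) • x‖ ^ 2) ≤ f x + √(R ^ 2 - ‖x‖ ^ 2) :=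
    hmax (mem_closedBall_zero_iff.2 (show ‖(1 - t) • x‖ ≤ R by rw [hnorm]; nlinarith))
  rw [hnorm, hxR, sub_self, Real.sqrt_zero, add_zero] at hm
  have hl := hK.dist_le_mul _ htU _ (mem_of_mem_nhds hU)
  have hd : dist ((1 - t) • x) x = t * R := by
    rw [dist_eq_norm, show (1 - t) • x - x = -(t • x) by module, norm_neg, norm_smul,
      Real.norm_of_nonneg ht0.le, hxR]
  rw [hd, Real.dist_eq] at hl
  have hle : √(R ^ 2 - ((1 - t) * R) ^ 2) ≤ K * (t * R) := by
    have := neg_abs_le (f ((1 - t) • x) - f x)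
    linarith
  rw [Real.sqrt_le_left (by positivity)] at hle
  have h3 : R ^ 2 * t * (2 - t) ≤ R ^ 2 * t * (K ^ 2 * t) := by linarith
  have h4 := le_of_mul_le_mul_left h3 (by positivity)
  linarith

/-- First- and second-order conditions where the graph of `f` touches the lower hemisphere
of radius `R` from below. -/
theorem fderiv_of_isLocalMax_add_sqrt (hf : ContDiff ℝ 2 f) {R : ℝ}
    {x : EuclideanSpace ℝ (Fin n)} (hx : 0 < R ^ 2 - ‖x‖ ^ 2)
    (hmax : IsLocalMax (fun y => f y + √(R ^ 2 - ‖y‖ ^ 2)) x) (v : EuclideanSpace ℝ (Fin n)) :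
    fderiv ℝ f x v = inner ℝ x v / √(R ^ 2 - ‖x‖ ^ 2) ∧
      fderiv ℝ (fderiv ℝ f) x v v ≤ ‖v‖ ^ 2 / √(R ^ 2 - ‖x‖ ^ 2) +
        inner ℝ x v ^ 2 / √(R ^ 2 - ‖x‖ ^ 2) ^ 3 := by
  set s := √(R ^ 2 - ‖x‖ ^ 2) with hs
  have hs0 : 0 < s := Real.sqrt_pos.2 hx
  let q : ℝ → ℝ := fun t => R ^ 2 - ‖x‖ ^ 2 - 2 * t * inner ℝ x v - t ^ 2 * ‖v‖ ^ 2
  have hq : ∀ t : ℝ, R ^ 2 - ‖x + t • v‖ ^ 2 = q t := fun t => by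
    simp only [q]
    rw [norm_add_sq_real, inner_smul_right, norm_smul, mul_pow, Real.norm_eq_abs, sq_abs]
    ring
  have hq0 : q 0 = R ^ 2 - ‖x‖ ^ 2 := by simp [q]
  have hline : ∀ t : ℝ, HasDerivAt (fun t : ℝ => x + t • v) v t := fun t => by
    simpa using ((hasDerivAt_id t).smul_const v).const_add x
  have hlinec : Filter.Tendsto (fun t : ℝ => x + t • v) (nhds 0) (nhds x) := by
    simpa using (hline 0).continuousAt.tendsto
  have hqd : ∀ t, HasDerivAt q (-2 * (inner ℝ x v + t * ‖v‖ ^ 2)) t := fun t => by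
    have h := (((((hasDerivAt_id t).const_mul 2).mul_const (inner ℝ x v)).const_sub
      (R ^ 2 - ‖x‖ ^ 2)).sub (((hasDerivAt_id t).pow 2).mul_const (‖v‖ ^ 2)))
    refine h.congr_deriv ?_
    simp
    ring
  have hsd : ∀ t, 0 < q t → HasDerivAt (fun t => √(q t))
      (-(inner ℝ x v + t * ‖v‖ ^ 2) / √(q t)) t := fun t ht => by
    refine ((hqd t).sqrt ht.ne').congr_deriv ?_
    have := (Real.sqrt_pos.2 ht).ne'
    field_simp
  have hmax' : IsLocalMax (fun t : ℝ => f (x + t • v) + √(q t)) 0 := by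
    have := hlinec.eventually hmax
    filter_upwards [this] with t ht
    simpa [hq, hq0] using ht
  have hd1 : ∀ᶠ t in nhds (0 : ℝ), HasDerivAt (fun t : ℝ => f (x + t • v) + √(q t))
      (fderiv ℝ f (x + t • v) v + -(inner ℝ x v + t * ‖v‖ ^ 2) / √(q t)) t := by
    have : ∀ᶠ t in nhds (0 : ℝ), 0 < q t :=
      (hqd 0).continuousAt.eventually (lt_mem_nhds (by rw [hq0]; exact hx))
    filter_upwards [this] with t ht
    refine HasDerivAt.add ?_ (hsd t ht)
    exact ((hf.differentiable two_ne_zero) _).hasFDerivAt.comp_hasDerivAt t (hline t)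
  have hd2 : HasDerivAt
      (fun t : ℝ => fderiv ℝ f (x + t • v) v + -(inner ℝ x v + t * ‖v‖ ^ 2) / √(q t))
      (fderiv ℝ (fderiv ℝ f) x v v - (‖v‖ ^ 2 / s + inner ℝ x v ^ 2 / s ^ 3)) 0 := by
    have hT : HasDerivAt (fun t : ℝ => fderiv ℝ f (x + t • v) v)
        (fderiv ℝ (fderiv ℝ f) x v v) 0 := by
      have h := ((hf.contDiff_one_fderiv.differentiable one_ne_zero)
        (x + (0 : ℝ) • v)).hasFDerivAt.comp_hasDerivAt 0 (hline 0)
      simpa using h.clm_apply (hasDerivAt_const (0 : ℝ) v)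
    have hN : HasDerivAt (fun t : ℝ => -(inner ℝ x v + t * ‖v‖ ^ 2)) (-‖v‖ ^ 2) 0 := by
      refine (((hasDerivAt_id (0 : ℝ)).mul_const (‖v‖ ^ 2)).const_add (inner ℝ x v)).neg.congr_deriv
        (by rw [one_mul])
    refine (hT.add (hN.div (hsd 0 (by rw [hq0]; exact hx))
      (by rw [hq0, ← hs]; exact hs0.ne'))).congr_deriv ?_
    rw [hq0, ← hs]
    field_simp
    ring
  refine ⟨?_, ?_⟩
  · have h := hmax'.hasDerivAt_eq_zero hd1.self_of_nhds
    rw [hq0, ← hs] at h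
    simp only [zero_smul, add_zero, zero_mul, neg_div] at h
    linarith
  · have h := hmax'.second_deriv_nonpos hd1 hd2
    linarith

theorem meanCurv_le_of_isLocalMax_add_sqrt (hn : 0 < n) (hf : ContDiff ℝ 2 f) {R : ℝ} (hR : 0 < R)
    {x : EuclideanSpace ℝ (Fin n)} (hx : 0 < R ^ 2 - ‖x‖ ^ 2)
    (hmax : IsLocalMax (fun y => f y + √(R ^ 2 - ‖y‖ ^ 2)) x) : meanCurv n f x ≤ R⁻¹ := by
  have hcond := fderiv_of_isLocalMax_add_sqrt hf hx hmax
  have hsq := Real.sq_sqrt hx.le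
  have hs0 : 0 < √(R ^ 2 - ‖x‖ ^ 2) := Real.sqrt_pos.2 hx
  set s := √(R ^ 2 - ‖x‖ ^ 2)
  have hxs : ∑ i, x i ^ 2 = ‖x‖ ^ 2 := (EuclideanSpace.real_norm_sq_eq x).symm
  have hgrad : ∀ i, grad n f x i = x i / s := fun i => by
    simp [grad, (hcond _).1, EuclideanSpace.inner_single_right]
  have hgradSq : 1 + gradSq n f x = (R / s) ^ 2 := by
    simp only [gradSq, hgrad, div_pow, ← Finset.sum_div, hxs]
    field_simp
    linarith
  let T := fderiv ℝ (fderiv ℝ f) x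
  let L : EuclideanSpace ℝ (Fin n) →ₗ[ℝ] EuclideanSpace ℝ (Fin n) →ₗ[ℝ] ℝ :=
    (ContinuousLinearMap.coeLM ℝ).comp T.toLinearMap
  let l := innerₗ (EuclideanSpace ℝ (Fin n)) x
  let B : EuclideanSpace ℝ (Fin n) →ₗ[ℝ] EuclideanSpace ℝ (Fin n) →ₗ[ℝ] ℝ :=
    L - s⁻¹ • innerₗ (EuclideanSpace ℝ (Fin n)) - (s ^ 3)⁻¹ • l.smulRight l
  have hBapp : ∀ v, B v v = T v v - (‖v‖ ^ 2 / s + inner ℝ x v ^ 2 / s ^ 3) := fun v => by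
    simp [B, L, l]
    ring
  have hB := sum_bilin_le_of_nonpos B (fun v => by rw [hBapp]; linarith [(hcond v).2]) hR hs0.le x
    (by rw [hxs]; linarith)
  have hsumT : ∑ i, ∑ j, grad n f x i * grad n f x j * hess n f x j i = T x x / s ^ 2 := by
    have hsum := sum_smul_single x
    have : T x x = ∑ i, ∑ j, x i * x j * T (EuclideanSpace.single j 1)
        (EuclideanSpace.single i 1) := by
      conv_lhs => rw [← hsum]
      simp only [map_sum, map_smul, _root_.sum_apply, _root_.smul_apply,
        smul_eq_mul, Finset.mul_sum]
      refine Finset.sum_congr rfl fun i _ => Finset.sum_congr rfl fun j _ => ?_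
      ring
    rw [this]
    simp only [hgrad, hess_apply hf, Finset.sum_div, T]
    refine Finset.sum_congr rfl fun i _ => Finset.sum_congr rfl fun j _ => ?_
    ring
  have hsumI : ∑ i : Fin n, B (EuclideanSpace.single i 1) (EuclideanSpace.single i 1) =
      ∑ i, hess n f x i i - (n / s + ‖x‖ ^ 2 / s ^ 3) := by
    simp only [hBapp, Finset.sum_sub_distrib, Finset.sum_add_distrib, hess_apply hf, T,
      ← Finset.sum_div]
    simp [EuclideanSpace.inner_single_right, hxs]
  rw [hsumI, hBapp, real_inner_self_eq_norm_sq, show ‖x‖ ^ 2 = R ^ 2 - s ^ 2 by linarith] at hB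
  have hmain : ∑ i, hess n f x i i - T x x / R ^ 2 ≤ n / s := by
    have e : (n / s + (R ^ 2 - s ^ 2) / s ^ 3) -
        ((R ^ 2 - s ^ 2) / s + (R ^ 2 - s ^ 2) ^ 2 / s ^ 3) / R ^ 2 = n / s := by
      field_simp
      ring
    rw [sub_div (T x x)] at hB
    linarith
  have hn' : (0 : ℝ) < n := by exact_mod_cast hn
  rw [meanCurv, trace_shapeOp, hgradSq, Real.sqrt_sq (by positivity), hsumT,
    show T x x / s ^ 2 / (R / s) ^ 2 = T x x / R ^ 2 by field_simp, inv_div, div_le_iff₀ hn']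
  calc s / R * (∑ i, hess n f x i i - T x x / R ^ 2) ≤ s / R * (n / s) := by gcongr
    _ = R⁻¹ * n := by field_simp

/-- On every ball of radius `R`, a graph has mean curvature at most `1 / R` somewhere. -/
theorem exists_meanCurv_le (hn : 0 < n) (hf : ContDiff ℝ 2 f) {R : ℝ} (hR : 0 < R) :
    ∃ x, meanCurv n f x ≤ R⁻¹ := by
  have hcont : Continuous fun y => f y + √(R ^ 2 - ‖y‖ ^ 2) := by
    have := hf.continuous
    fun_prop
  obtain ⟨x, hx, hmax⟩ := (isCompact_closedBall (0 : EuclideanSpace ℝ (Fin n)) R).exists_isMaxOn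
    ⟨0, mem_closedBall_self hR.le⟩ hcont.continuousOn
  have hlt := norm_lt_of_isMaxOn_add_sqrt hf hR hx hmax
  refine ⟨x, meanCurv_le_of_isLocalMax_add_sqrt hn hf hR ?_ (hmax.isLocalMax ?_)⟩
  · have := norm_nonneg x
    nlinarith
  · exact Filter.mem_of_superset (isOpen_ball.mem_nhds (mem_ball_zero_iff.2 hlt))
      ball_subset_closedBall

end Touching

/-- **Chern–Flanders theorem.** An entire graph in `ℝ^{n+1}`, `n ≥ 2`, cannot have
mean curvature bounded away from zero: `inf |H| = 0`, i.e. for every `ε > 0`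
there is a point where `|H| < ε`. -/
theorem inf_meanCurv_entire_graph_eq_zero
    (n : ℕ) (hn : 2 ≤ n)
    (f : EuclideanSpace ℝ (Fin n) → ℝ) (hf : ContDiff ℝ 2 f) :
    ∀ ε > 0, ∃ x : EuclideanSpace ℝ (Fin n), |meanCurv n f x| < ε := by
  intro ε hε
  have hn0 : 0 < n := by omega
  have hR : 0 < 2 / ε := by positivity
  obtain ⟨x, hx⟩ := exists_meanCurv_le hn0 hf hR
  obtain ⟨y, hy⟩ := exists_meanCurv_le hn0 (f := -f) hf.neg hR
  rw [meanCurv_neg] at hy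
  rw [inv_div] at hx hy
  by_contra! h
  have hx' : meanCurv n f x ≤ 0 := by
    rcases le_abs.1 (h x) with h1 | h1 <;> linarith
  have hy' : 0 ≤ meanCurv n f y := by
    rcases le_abs.1 (h y) with h1 | h1 <;> linarith
  obtain ⟨z, hz⟩ := mem_range_of_exists_le_of_exists_ge (continuous_meanCurv hf) ⟨x, hx'⟩ ⟨y, hy'⟩
  have := h z
  rw [hz, abs_zero] at this
  linarith
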